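/- There is a constant C≥1 such that for every finite word 𝔦∈𝓘* and all a,b∈[0,1]², the singular values of the Jacobians at different base points are comparable: C⁻¹·α₁(D_bS_𝔦) ≤ α₁(D_aS_𝔦) ≤ C·α₁(D_bS_𝔦) and C⁻¹·α₂(D_bS_𝔦) ≤ α₂(D_aS_𝔦) ≤ C·α₂(D_bS_𝔦). -/

import Mathlib

/-!
Setting (Falconer–Fraser–Lee, "L^q-spectra of measures on planar non-conformal attractors"):
a finite family of C^{1+α} skew-product contractions
`S i (x,y) = (f i x, g i (x,y))` of the unit square, satisfying a domination
condition on the (lower triangular) Jacobians.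
-/

open Set Filter Topology MeasureTheory
open scoped Classical ENNReal

noncomputable section

/-- The closed unit square `[0,1]² ⊆ ℝ²`. -/
def unitSq : Set (ℝ × ℝ) := Set.Icc (0:ℝ) 1 ×ˢ Set.Icc (0:ℝ) 1

variable {ι : Type*} [Fintype ι]

/-- The skew-product map `S_i(x,y) = (f_i x, g_i (x,y))`. -/
def Smap (f : ι → ℝ → ℝ) (g : ι → ℝ × ℝ → ℝ) (i : ι) : ℝ × ℝ → ℝ × ℝ :=
  fun a => (f i a.1, g i a)

/-- The composition `S_𝔦 = S_{i₁} ∘ ⋯ ∘ S_{i_k}` along a finite word `𝔦 = [i₁, …, i_k]`. -/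
def Sword (f : ι → ℝ → ℝ) (g : ι → ℝ × ℝ → ℝ) : List ι → ℝ × ℝ → ℝ × ℝ
  | [] => id
  | i :: l => Smap f g i ∘ Sword f g l

/-- The first component `f_𝔦 = f_{i₁} ∘ ⋯ ∘ f_{i_k}` of `S_𝔦` (a function of `x` only). -/
def fword (f : ι → ℝ → ℝ) : List ι → ℝ → ℝ
  | [] => id
  | i :: l => f i ∘ fword f l

/-- Top-left entry `f_{𝔦,x}(a)` of the (lower triangular) Jacobian `D_a S_𝔦`. -/
def fxw (f : ι → ℝ → ℝ) (g : ι → ℝ × ℝ → ℝ) (l : List ι) (a : ℝ × ℝ) : ℝ :=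
  deriv (fun x => (Sword f g l (x, a.2)).1) a.1

/-- Bottom-left entry `g_{𝔦,x}(a)` of the Jacobian `D_a S_𝔦`. -/
def gxw (f : ι → ℝ → ℝ) (g : ι → ℝ × ℝ → ℝ) (l : List ι) (a : ℝ × ℝ) : ℝ :=
  deriv (fun x => (Sword f g l (x, a.2)).2) a.1

/-- Bottom-right entry `g_{𝔦,y}(a)` of the Jacobian `D_a S_𝔦`. -/
def gyw (f : ι → ℝ → ℝ) (g : ι → ℝ × ℝ → ℝ) (l : List ι) (a : ℝ × ℝ) : ℝ :=
  deriv (fun y => (Sword f g l (a.1, y)).2) a.2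

/-- The standing hypotheses: `|𝓘| ≥ 2`; each `S_i(x,y) = (f_i x, g_i(x,y))` maps the unit
square into itself; `f_i, g_i` are `C^{1+α}` contractions (`0 < α ≤ 1`); and the
domination condition `inf f_{i,x} > sup g_{i,y} ≥ inf g_{i,y} ≥ d > 0` holds. -/
structure IFSHyp (f : ι → ℝ → ℝ) (g : ι → ℝ × ℝ → ℝ) (α d : ℝ) : Prop where
  card2 : 2 ≤ Fintype.card ι
  alpha_pos : 0 < α
  alpha_le_one : α ≤ 1
  d_pos : 0 < d
  maps_f : ∀ i, Set.MapsTo (f i) (Set.Icc 0 1) (Set.Icc 0 1)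
  maps_g : ∀ i, Set.MapsTo (g i) unitSq (Set.Icc 0 1)
  diff_f : ∀ i, Differentiable ℝ (f i)
  diff_g : ∀ i, Differentiable ℝ (g i)
  holder_f : ∀ i, ∃ H : ℝ, ∀ x ∈ Set.Icc (0:ℝ) 1, ∀ y ∈ Set.Icc (0:ℝ) 1,
      |deriv (f i) x - deriv (f i) y| ≤ H * |x - y| ^ α
  holder_g : ∀ i, ∃ H : ℝ, ∀ a ∈ unitSq, ∀ b ∈ unitSq,
      ‖fderiv ℝ (g i) a - fderiv ℝ (g i) b‖ ≤ H * ‖a - b‖ ^ α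
  contr_f : ∀ i, ∃ c, 0 ≤ c ∧ c < 1 ∧ ∀ x ∈ Set.Icc (0:ℝ) 1, ∀ y ∈ Set.Icc (0:ℝ) 1,
      |f i x - f i y| ≤ c * |x - y|
  contr_g : ∀ i, ∃ c, 0 ≤ c ∧ c < 1 ∧ ∀ a ∈ unitSq, ∀ b ∈ unitSq,
      |g i a - g i b| ≤ c * ‖a - b‖
  dom : ∀ i, sSup (gyw f g [i] '' unitSq) < sInf (fxw f g [i] '' unitSq)
  dom_d : ∀ i, ∀ a ∈ unitSq, d ≤ gyw f g [i] a

/-- The larger singular value of the lower triangular matrix `A = [[a,0],[b,c]]`, i.e. the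
square root of the larger eigenvalue of `AᵀA`, in explicit closed form. -/
def sv1 (a b c : ℝ) : ℝ :=
  Real.sqrt (((a ^ 2 + b ^ 2 + c ^ 2) +
    Real.sqrt ((a ^ 2 + b ^ 2 + c ^ 2) ^ 2 - 4 * (a * c) ^ 2)) / 2)

/-- The smaller singular value of the lower triangular matrix `A = [[a,0],[b,c]]`, i.e. the
square root of the smaller eigenvalue of `AᵀA`, in explicit closed form. -/
def sv2 (a b c : ℝ) : ℝ :=
  Real.sqrt (((a ^ 2 + b ^ 2 + c ^ 2) -
    Real.sqrt ((a ^ 2 + b ^ 2 + c ^ 2) ^ 2 - 4 * (a * c) ^ 2)) / 2)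

/-- `α₁(D_a S_𝔦)`, the larger singular value of the Jacobian. -/
def alphaOne (f : ι → ℝ → ℝ) (g : ι → ℝ × ℝ → ℝ) (l : List ι) (a : ℝ × ℝ) : ℝ :=
  sv1 (fxw f g l a) (gxw f g l a) (gyw f g l a)

/-- `α₂(D_a S_𝔦)`, the smaller singular value of the Jacobian. -/
def alphaTwo (f : ι → ℝ → ℝ) (g : ι → ℝ × ℝ → ℝ) (l : List ι) (a : ℝ × ℝ) : ℝ :=
  sv2 (fxw f g l a) (gxw f g l a) (gyw f g l a)

/-- `η = sup_{i, a, b} g_{i,y}(a) / f_{i,x}(b)`. -/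
def etaSup (f : ι → ℝ → ℝ) (g : ι → ℝ × ℝ → ℝ) : ℝ :=
  sSup {x : ℝ | ∃ i : ι, ∃ a ∈ unitSq, ∃ b ∈ unitSq, x = gyw f g [i] a / fxw f g [i] b}

/-- `p(𝔦) = p_{i₁} ⋯ p_{i_k}`. -/
def pword (p : ι → ℝ) (l : List ι) : ℝ := (l.map p).prod

/-- `(p_i)` is a probability vector with all entries in `(0,1)`. -/
def ProbVec (p : ι → ℝ) : Prop := (∀ i, 0 < p i ∧ p i < 1) ∧ ∑ i, p i = 1

/-- The `q`-modified singular value function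
`ψ^{s,q}_a(𝔦) = p(𝔦)^q α₁(D_aS_𝔦)^βq α₂(D_aS_𝔦)^(s−βq)` (real exponents). -/
def psiSV (f : ι → ℝ → ℝ) (g : ι → ℝ × ℝ → ℝ) (p : ι → ℝ) (s q βq : ℝ)
    (a : ℝ × ℝ) (l : List ι) : ℝ :=
  pword p l ^ q * alphaOne f g l a ^ βq * alphaTwo f g l a ^ (s - βq)

/-- `Ψ^{s,q}_{a,k} = Σ_{𝔦 ∈ 𝓘^k} ψ^{s,q}_a(𝔦)`. -/
def PsiSum (f : ι → ℝ → ℝ) (g : ι → ℝ × ℝ → ℝ) (p : ι → ℝ) (s q βq : ℝ)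
    (a : ℝ × ℝ) (k : ℕ) : ℝ :=
  ∑ w : Fin k → ι, psiSV f g p s q βq a (List.ofFn w)

/-- The `δ`-stopping `𝓘_{a,δ} = {𝔦 : α₂(D_aS_𝔦) < δ ≤ α₂(D_aS_𝔦̂)}`, where `𝔦̂` drops the
last letter of `𝔦`. -/
def stopping (f : ι → ℝ → ℝ) (g : ι → ℝ × ℝ → ℝ) (a : ℝ × ℝ) (δ : ℝ) : Set (List ι) :=
  {l | l ≠ [] ∧ alphaTwo f g l a < δ ∧ δ ≤ alphaTwo f g l.dropLast a}

/-- `q`-th power moment sum of a measure on `ℝ` over the `δ`-mesh intervals of positive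
measure. -/
def msum1 (ν : Measure ℝ) (q δ : ℝ) : ℝ :=
  ∑' k : ℤ, if 0 < ν (Set.Icc ((k : ℝ) * δ) (((k : ℝ) + 1) * δ)) then
    (ν (Set.Icc ((k : ℝ) * δ) (((k : ℝ) + 1) * δ))).toReal ^ q else 0

/-- `q`-th power moment sum of a measure on `ℝ²` over the `δ`-mesh squares of positive
measure. -/
def msum2 (ν : Measure (ℝ × ℝ)) (q δ : ℝ) : ℝ :=
  ∑' k : ℤ × ℤ,
    if 0 < ν (Set.Icc ((k.1 : ℝ) * δ) (((k.1 : ℝ) + 1) * δ) ×ˢ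
        Set.Icc ((k.2 : ℝ) * δ) (((k.2 : ℝ) + 1) * δ)) then
      (ν (Set.Icc ((k.1 : ℝ) * δ) (((k.1 : ℝ) + 1) * δ) ×ˢ
        Set.Icc ((k.2 : ℝ) * δ) (((k.2 : ℝ) + 1) * δ))).toReal ^ q else 0

/-- Upper `L^q`-spectrum of a measure on `ℝ²`. -/
def upperTau2 (ν : Measure (ℝ × ℝ)) (q : ℝ) : ℝ :=
  limsup (fun δ => Real.log (msum2 ν q δ) / (-Real.log δ)) (𝓝[>] (0:ℝ))

/-- Lower `L^q`-spectrum of a measure on `ℝ²`. -/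
def lowerTau2 (ν : Measure (ℝ × ℝ)) (q : ℝ) : ℝ :=
  liminf (fun δ => Real.log (msum2 ν q δ) / (-Real.log δ)) (𝓝[>] (0:ℝ))

section SingularValues

lemma sv1_mem_Icc {a b c K : ℝ} (ha : 0 < a) (hc : 0 ≤ c) (hca : c ≤ a) (hK : 0 ≤ K)
    (hb : |b| ≤ K * a) : sv1 a b c ∈ Set.Icc (a / 2) ((2 + K) * a) := by
  have hb2 : b ^ 2 ≤ (K * a) ^ 2 := sq_le_sq' (abs_le.mp hb).1 (abs_le.mp hb).2
  have hc2 : c ^ 2 ≤ a ^ 2 := by gcongr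
  have hs : √((a ^ 2 + b ^ 2 + c ^ 2) ^ 2 - 4 * (a * c) ^ 2) ≤ a ^ 2 + b ^ 2 + c ^ 2 :=
    Real.sqrt_le_iff.mpr ⟨by positivity, by nlinarith [sq_nonneg (a * c)]⟩
  have hs0 := Real.sqrt_nonneg ((a ^ 2 + b ^ 2 + c ^ 2) ^ 2 - 4 * (a * c) ^ 2)
  have hKa : 0 ≤ K * a ^ 2 := by positivity
  refine ⟨Real.le_sqrt_of_sq_le ?_, Real.sqrt_le_iff.mpr ⟨by positivity, ?_⟩⟩
  · nlinarith [sq_nonneg b, sq_nonneg c]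
  · nlinarith

lemma sv1_mul_sv2 {a b c : ℝ} (ha : 0 ≤ a) (hc : 0 ≤ c) : sv1 a b c * sv2 a b c = a * c := by
  have hD : 0 ≤ (a ^ 2 + b ^ 2 + c ^ 2) ^ 2 - 4 * (a * c) ^ 2 := by
    have h1 : 2 * (a * c) ≤ a ^ 2 + b ^ 2 + c ^ 2 := by
      nlinarith [sq_nonneg (a - c), sq_nonneg b]
    have h2 : 0 ≤ a * c := mul_nonneg ha hc
    nlinarith
  have hs := Real.sq_sqrt hD
  have hs0 := Real.sqrt_nonneg ((a ^ 2 + b ^ 2 + c ^ 2) ^ 2 - 4 * (a * c) ^ 2)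
  rw [sv1, sv2, ← Real.sqrt_mul (by positivity)]
  rw [show ∀ T s : ℝ, (T + s) / 2 * ((T - s) / 2) = (T ^ 2 - s ^ 2) / 4 by intros; ring, hs,
    show ∀ T D : ℝ, (T - (T - 4 * D)) / 4 = D by intros; ring, Real.sqrt_sq (mul_nonneg ha hc)]

end SingularValues

section Derivatives

variable {ι : Type*} {f : ι → ℝ → ℝ} {g : ι → ℝ × ℝ → ℝ}

lemma Sword_fst_congr (l : List ι) {a b : ℝ × ℝ} (hab : a.1 = b.1) :
    (Sword f g l a).1 = (Sword f g l b).1 := by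
  induction l with
  | nil => exact hab
  | cons i l ih => simp only [Sword, Smap, Function.comp_apply, ih]

lemma differentiable_Sword (hf : ∀ i, Differentiable ℝ (f i))
    (hg : ∀ i, Differentiable ℝ (g i)) (l : List ι) : Differentiable ℝ (Sword f g l) := by
  induction l with
  | nil => exact differentiable_id
  | cons i l ih => exact (((hf i).comp differentiable_fst).prodMk (hg i)).comp ih

lemma hasDerivAt_Sword_fst (hf : ∀ i, Differentiable ℝ (f i))
    (hg : ∀ i, Differentiable ℝ (g i)) (l : List ι) (a : ℝ × ℝ) :
    HasDerivAt (fun x => Sword f g l (x, a.2)) (fxw f g l a, gxw f g l a) a.1 := by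
  have hS : DifferentiableAt ℝ (fun x => Sword f g l (x, a.2)) a.1 :=
    ((differentiable_Sword hf hg l).comp
      (differentiable_id.prodMk (differentiable_const a.2))).differentiableAt
  exact hS.fst.hasDerivAt.prodMk hS.snd.hasDerivAt

lemma hasDerivAt_Sword_snd (hf : ∀ i, Differentiable ℝ (f i))
    (hg : ∀ i, Differentiable ℝ (g i)) (l : List ι) (a : ℝ × ℝ) :
    HasDerivAt (fun y => Sword f g l (a.1, y)) (0, gyw f g l a) a.2 := by
  have hS : DifferentiableAt ℝ (fun y => Sword f g l (a.1, y)) a.2 :=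
    ((differentiable_Sword hf hg l).comp
      ((differentiable_const a.1).prodMk differentiable_id)).differentiableAt
  have h0 : HasDerivAt (fun y => (Sword f g l (a.1, y)).1) 0 a.2 :=
    (hasDerivAt_const a.2 (Sword f g l a).1).congr_of_eventuallyEq
      (Eventually.of_forall fun _ => Sword_fst_congr l rfl)
  exact h0.prodMk hS.snd.hasDerivAt

lemma fxw_nil (a : ℝ × ℝ) : fxw f g [] a = 1 := by simp [fxw, Sword]

lemma gxw_nil (a : ℝ × ℝ) : gxw f g [] a = 0 := by simp [gxw, Sword]

lemma gyw_nil (a : ℝ × ℝ) : gyw f g [] a = 1 := by simp [gyw, Sword]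

lemma fxw_cons (hf : ∀ i, Differentiable ℝ (f i)) (hg : ∀ i, Differentiable ℝ (g i))
    (i : ι) (l : List ι) (a : ℝ × ℝ) :
    fxw f g (i :: l) a = deriv (f i) (Sword f g l a).1 * fxw f g l a :=
  ((hf i _).hasDerivAt.comp a.1 (hasDerivAt_Sword_fst hf hg l a).fst).deriv

lemma gxw_cons (hf : ∀ i, Differentiable ℝ (f i)) (hg : ∀ i, Differentiable ℝ (g i))
    (i : ι) (l : List ι) (a : ℝ × ℝ) :
    gxw f g (i :: l) a = fderiv ℝ (g i) (Sword f g l a) (1, 0) * fxw f g l a +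
      fderiv ℝ (g i) (Sword f g l a) (0, 1) * gxw f g l a := by
  have h := ((hg i _).hasFDerivAt.comp_hasDerivAt a.1 (hasDerivAt_Sword_fst hf hg l a)).deriv
  have hv : ((fxw f g l a, gxw f g l a) : ℝ × ℝ) =
      fxw f g l a • ((1, 0) : ℝ × ℝ) + gxw f g l a • ((0, 1) : ℝ × ℝ) := by simp
  rw [hv, map_add, map_smul, map_smul, smul_eq_mul, smul_eq_mul] at h
  rw [mul_comm _ (fxw f g l a), mul_comm _ (gxw f g l a)]
  exact h

lemma gyw_cons (hf : ∀ i, Differentiable ℝ (f i)) (hg : ∀ i, Differentiable ℝ (g i))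
    (i : ι) (l : List ι) (a : ℝ × ℝ) :
    gyw f g (i :: l) a = fderiv ℝ (g i) (Sword f g l a) (0, 1) * gyw f g l a := by
  have h := ((hg i _).hasFDerivAt.comp_hasDerivAt a.2 (hasDerivAt_Sword_snd hf hg l a)).deriv
  have hv : ((0, gyw f g l a) : ℝ × ℝ) = gyw f g l a • ((0, 1) : ℝ × ℝ) := by simp
  rw [hv, map_smul, smul_eq_mul] at h
  rw [mul_comm]
  exact h

end Derivatives

section UniformBounds

lemma zero_mem_unitSq : (0 : ℝ × ℝ) ∈ unitSq :=
  ⟨⟨le_rfl, zero_le_one⟩, le_rfl, zero_le_one⟩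

lemma norm_sub_le_one_of_mem_unitSq {a b : ℝ × ℝ} (ha : a ∈ unitSq) (hb : b ∈ unitSq) :
    ‖a - b‖ ≤ 1 := by
  obtain ⟨⟨h1, h2⟩, h3, h4⟩ := ha
  obtain ⟨⟨h5, h6⟩, h7, h8⟩ := hb
  simp only [Prod.norm_def, Prod.fst_sub, Prod.snd_sub, Real.norm_eq_abs, sup_le_iff, abs_le]
  refine ⟨⟨?_, ?_⟩, ?_, ?_⟩ <;> linarith

variable {f : ι → ℝ → ℝ} {g : ι → ℝ × ℝ → ℝ} {α d : ℝ}

lemma IFSHyp.nonempty (h : IFSHyp f g α d) : Nonempty ι :=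
  Fintype.card_pos_iff.mp (by have := h.card2; omega)

lemma IFSHyp.mapsTo_Sword (h : IFSHyp f g α d) (l : List ι) :
    MapsTo (Sword f g l) unitSq unitSq := by
  induction l with
  | nil => exact mapsTo_id _
  | cons i l ih => exact fun a ha => ⟨h.maps_f i (ih ha).1, h.maps_g i (ih ha)⟩

lemma IFSHyp.exists_contraction (h : IFSHyp f g α d) :
    ∃ c, 0 ≤ c ∧ c < 1 ∧ ∀ i, ∀ a ∈ unitSq, ∀ b ∈ unitSq,
      ‖Smap f g i a - Smap f g i b‖ ≤ c * ‖a - b‖ := by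
  have := h.nonempty
  choose u hu0 hu1 hu using h.contr_f
  choose v hv0 hv1 hv using h.contr_g
  obtain ⟨j, hj⟩ := Finite.exists_max fun i => max (u i) (v i)
  refine ⟨max (u j) (v j), le_max_of_le_left (hu0 j), max_lt (hu1 j) (hv1 j),
    fun i a ha b hb => max_le ?_ ?_⟩
  · calc ‖f i a.1 - f i b.1‖ ≤ u i * ‖a.1 - b.1‖ := hu i _ ha.1 _ hb.1
      _ ≤ max (u j) (v j) * ‖a - b‖ :=
        mul_le_mul ((le_max_left _ _).trans (hj i)) (norm_fst_le (a - b)) (norm_nonneg _)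
          (le_max_of_le_left (hu0 j))
  · calc ‖g i a - g i b‖ ≤ v i * ‖a - b‖ := hv i _ ha _ hb
      _ ≤ max (u j) (v j) * ‖a - b‖ := by
        gcongr
        exact (le_max_right _ _).trans (hj i)

lemma norm_Sword_sub_le (h : IFSHyp f g α d) {c : ℝ} (hc : 0 ≤ c)
    (hS : ∀ i, ∀ a ∈ unitSq, ∀ b ∈ unitSq, ‖Smap f g i a - Smap f g i b‖ ≤ c * ‖a - b‖)
    (l : List ι) {a b : ℝ × ℝ} (ha : a ∈ unitSq) (hb : b ∈ unitSq) :
    ‖Sword f g l a - Sword f g l b‖ ≤ c ^ l.length := by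
  induction l with
  | nil => simpa [Sword] using norm_sub_le_one_of_mem_unitSq ha hb
  | cons i l ih =>
    calc ‖Sword f g (i :: l) a - Sword f g (i :: l) b‖
        ≤ c * ‖Sword f g l a - Sword f g l b‖ :=
          hS i _ (h.mapsTo_Sword l ha) _ (h.mapsTo_Sword l hb)
      _ ≤ c ^ (i :: l).length := by
          rw [List.length_cons, pow_succ']
          gcongr

lemma IFSHyp.exists_holder_deriv_f (h : IFSHyp f g α d) :
    ∃ H, 0 ≤ H ∧ ∀ i, ∀ a ∈ unitSq, ∀ b ∈ unitSq,
      |deriv (f i) a.1 - deriv (f i) b.1| ≤ H * ‖a - b‖ ^ α := by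
  have := h.nonempty
  choose H hH using h.holder_f
  obtain ⟨j, hj⟩ := Finite.exists_max fun i => |H i|
  refine ⟨|H j|, abs_nonneg _, fun i a ha b hb => (hH i _ ha.1 _ hb.1).trans ?_⟩
  exact mul_le_mul ((le_abs_self _).trans (hj i))
    (Real.rpow_le_rpow (abs_nonneg _) (norm_fst_le (a - b)) h.alpha_pos.le)
    (Real.rpow_nonneg (abs_nonneg _) _) (abs_nonneg _)

lemma IFSHyp.exists_holder_fderiv_g (h : IFSHyp f g α d) :
    ∃ H, 0 ≤ H ∧ ∀ i, ∀ a ∈ unitSq, ∀ b ∈ unitSq,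
      ‖fderiv ℝ (g i) a - fderiv ℝ (g i) b‖ ≤ H * ‖a - b‖ ^ α := by
  have := h.nonempty
  choose H hH using h.holder_g
  obtain ⟨j, hj⟩ := Finite.exists_max fun i => |H i|
  refine ⟨|H j|, abs_nonneg _, fun i a ha b hb => (hH i _ ha _ hb).trans ?_⟩
  gcongr
  exact (le_abs_self _).trans (hj i)

lemma IFSHyp.exists_norm_fderiv_g_le (h : IFSHyp f g α d) :
    ∃ G, 0 ≤ G ∧ ∀ i, ∀ a ∈ unitSq, ‖fderiv ℝ (g i) a‖ ≤ G := by
  have := h.nonempty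
  obtain ⟨H, hH0, hH⟩ := h.exists_holder_fderiv_g
  obtain ⟨j, hj⟩ := Finite.exists_max fun i => ‖fderiv ℝ (g i) 0‖
  refine ⟨‖fderiv ℝ (g j) 0‖ + H, by positivity, fun i a ha => ?_⟩
  have h1 := hH i a ha 0 zero_mem_unitSq
  have h2 : H * ‖a - 0‖ ^ α ≤ H := mul_le_of_le_one_right hH0 (Real.rpow_le_one (norm_nonneg _)
    (norm_sub_le_one_of_mem_unitSq ha zero_mem_unitSq) h.alpha_pos.le)
  linarith [norm_le_norm_add_norm_sub' (fderiv ℝ (g i) a) (fderiv ℝ (g i) 0), hj i]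

lemma abs_apply_one_zero_le (L : ℝ × ℝ →L[ℝ] ℝ) : |L (1, 0)| ≤ ‖L‖ := by
  simpa [Prod.norm_def] using L.le_opNorm (1, 0)

lemma abs_apply_zero_one_le (L : ℝ × ℝ →L[ℝ] ℝ) : |L (0, 1)| ≤ ‖L‖ := by
  simpa [Prod.norm_def] using L.le_opNorm (0, 1)

lemma IFSHyp.gyw_singleton (h : IFSHyp f g α d) (i : ι) (a : ℝ × ℝ) :
    gyw f g [i] a = fderiv ℝ (g i) a (0, 1) := by
  rw [gyw_cons h.diff_f h.diff_g, gyw_nil, mul_one]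
  rfl

lemma IFSHyp.fxw_singleton (h : IFSHyp f g α d) (i : ι) (a : ℝ × ℝ) :
    fxw f g [i] a = deriv (f i) a.1 := by
  rw [fxw_cons h.diff_f h.diff_g, fxw_nil, mul_one]
  rfl

lemma IFSHyp.le_fderiv_g (h : IFSHyp f g α d) (i : ι) {a : ℝ × ℝ} (ha : a ∈ unitSq) :
    d ≤ fderiv ℝ (g i) a (0, 1) :=
  h.gyw_singleton i a ▸ h.dom_d i a ha

/-- Domination with a uniform gap between the two diagonal entries of the Jacobians. -/
lemma IFSHyp.exists_domination_ratio (h : IFSHyp f g α d) :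
    ∃ η, 0 ≤ η ∧ η < 1 ∧ ∀ i, ∀ a ∈ unitSq,
      fderiv ℝ (g i) a (0, 1) ≤ η * deriv (f i) a.1 := by
  have := h.nonempty
  obtain ⟨G, -, hG⟩ := h.exists_norm_fderiv_g_le
  obtain ⟨H, hH0, hH⟩ := h.exists_holder_deriv_f
  have hle : ∀ i, ∀ a ∈ unitSq, fderiv ℝ (g i) a (0, 1) ≤ sSup (gyw f g [i] '' unitSq) := by
    intro i a ha
    refine le_csSup ⟨G, ?_⟩ ⟨a, ha, h.gyw_singleton i a⟩
    rintro _ ⟨b, hb, rfl⟩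
    rw [h.gyw_singleton]
    exact (le_abs_self _).trans ((abs_apply_zero_one_le _).trans (hG i b hb))
  have hge : ∀ i, ∀ a ∈ unitSq, sInf (fxw f g [i] '' unitSq) ≤ deriv (f i) a.1 := by
    intro i a ha
    refine csInf_le ⟨deriv (f i) 0 - H, ?_⟩ ⟨a, ha, h.fxw_singleton i a⟩
    rintro _ ⟨b, hb, rfl⟩
    rw [h.fxw_singleton]
    have h1 := hH i b hb 0 zero_mem_unitSq
    have h2 : H * ‖b - 0‖ ^ α ≤ H := mul_le_of_le_one_right hH0
      (Real.rpow_le_one (norm_nonneg _)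
        (norm_sub_le_one_of_mem_unitSq hb zero_mem_unitSq) h.alpha_pos.le)
    have h3 := (abs_le.mp (h1.trans h2)).1
    simp only [Prod.fst_zero] at h3
    linarith
  have hsup : ∀ i, 0 < sSup (gyw f g [i] '' unitSq) := fun i =>
    h.d_pos.trans_le ((h.le_fderiv_g i zero_mem_unitSq).trans (hle i 0 zero_mem_unitSq))
  have hinf : ∀ i, 0 < sInf (fxw f g [i] '' unitSq) := fun i => (hsup i).trans (h.dom i)
  obtain ⟨j, hj⟩ := Finite.exists_max fun i =>
    sSup (gyw f g [i] '' unitSq) / sInf (fxw f g [i] '' unitSq)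
  refine ⟨_, (div_pos (hsup j) (hinf j)).le, (div_lt_one (hinf j)).mpr (h.dom j),
    fun i a ha => ?_⟩
  calc fderiv ℝ (g i) a (0, 1) ≤ sSup (gyw f g [i] '' unitSq) := hle i a ha
    _ = sSup (gyw f g [i] '' unitSq) / sInf (fxw f g [i] '' unitSq) *
        sInf (fxw f g [i] '' unitSq) := (div_mul_cancel₀ _ (hinf i).ne').symm
    _ ≤ _ := mul_le_mul (hj i) (hge i a ha) (hinf i).le (div_pos (hsup j) (hinf j)).le

lemma IFSHyp.le_deriv_f (h : IFSHyp f g α d) (i : ι) {a : ℝ × ℝ} (ha : a ∈ unitSq) :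
    d ≤ deriv (f i) a.1 := by
  obtain ⟨η, hη0, hη1, hη⟩ := h.exists_domination_ratio
  have h1 := (h.le_fderiv_g i ha).trans (hη i a ha)
  have h2 : 0 < deriv (f i) a.1 := pos_of_mul_pos_right (h.d_pos.trans_le h1) hη0
  nlinarith

end UniformBounds

section Distortion

variable {f : ι → ℝ → ℝ} {g : ι → ℝ × ℝ → ℝ} {α d : ℝ}

lemma cocycle_pos (h : IFSHyp f g α d) {u : ι → ℝ × ℝ → ℝ}
    (hud : ∀ i, ∀ a ∈ unitSq, d ≤ u i a) {P : List ι → ℝ × ℝ → ℝ} (hP0 : ∀ a, P [] a = 1)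
    (hP : ∀ i l a, P (i :: l) a = u i (Sword f g l a) * P l a) (l : List ι) {a : ℝ × ℝ}
    (ha : a ∈ unitSq) : 0 < P l a := by
  induction l with
  | nil => rw [hP0]; exact one_pos
  | cons i l ih =>
    rw [hP]
    exact mul_pos (h.d_pos.trans_le (hud i _ (h.mapsTo_Sword l ha))) ih

/-- Bounded distortion for multiplicative cocycles over the system whose generators are Hölder
continuous and bounded away from zero. -/
lemma IFSHyp.exists_cocycle_distortion (h : IFSHyp f g α d) {u : ι → ℝ × ℝ → ℝ}
    (hud : ∀ i, ∀ a ∈ unitSq, d ≤ u i a) {H : ℝ} (hH0 : 0 ≤ H)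
    (hH : ∀ i, ∀ a ∈ unitSq, ∀ b ∈ unitSq, |u i a - u i b| ≤ H * ‖a - b‖ ^ α)
    {P : List ι → ℝ × ℝ → ℝ} (hP0 : ∀ a, P [] a = 1)
    (hP : ∀ i l a, P (i :: l) a = u i (Sword f g l a) * P l a) :
    ∃ C, 1 ≤ C ∧ ∀ l, ∀ a ∈ unitSq, ∀ b ∈ unitSq, P l a ≤ C * P l b := by
  obtain ⟨c, hc0, hc1, hc⟩ := h.exists_contraction
  have hρ0 : 0 ≤ c ^ α := Real.rpow_nonneg hc0 α
  have hρ1 : c ^ α < 1 := Real.rpow_lt_one hc0 hc1 h.alpha_pos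
  have hHd : 0 ≤ H / d := div_nonneg hH0 h.d_pos.le
  have key : ∀ l, ∀ a ∈ unitSq, ∀ b ∈ unitSq,
      P l a ≤ Real.exp (H / d * ∑ k ∈ Finset.range l.length, (c ^ α) ^ k) * P l b := by
    intro l a ha b hb
    induction l with
    | nil => simp [hP0]
    | cons i l ih =>
      have hSa := h.mapsTo_Sword l ha
      have hSb := h.mapsTo_Sword l hb
      have hub := hud i _ hSb
      have hu : u i (Sword f g l a) ≤
          Real.exp (H / d * (c ^ α) ^ l.length) * u i (Sword f g l b) := by
        have h1 : H * ‖Sword f g l a - Sword f g l b‖ ^ α ≤ H * (c ^ α) ^ l.length := by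
          rw [Real.rpow_pow_comm hc0]
          gcongr
          · exact h.alpha_pos.le
          · exact norm_Sword_sub_le h hc0 hc l ha hb
        have h2 : H * (c ^ α) ^ l.length ≤
            H / d * (c ^ α) ^ l.length * u i (Sword f g l b) := by
          calc H * (c ^ α) ^ l.length = H / d * (c ^ α) ^ l.length * d := by
                have := h.d_pos.ne'
                field_simp
            _ ≤ _ := by gcongr
        have h3 := (abs_le.mp ((hH i _ hSa _ hSb).trans h1)).2
        have h4 := mul_le_mul_of_nonneg_right
          (Real.add_one_le_exp (H / d * (c ^ α) ^ l.length)) (h.d_pos.le.trans hub)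
        linarith
      rw [hP, hP, List.length_cons, Finset.sum_range_succ, mul_add, add_comm (H / d * _),
        Real.exp_add, mul_mul_mul_comm]
      exact mul_le_mul hu ih (cocycle_pos h hud hP0 hP l ha).le
        (mul_nonneg (Real.exp_nonneg _) (h.d_pos.le.trans hub))
  refine ⟨Real.exp (H / d * (1 - c ^ α)⁻¹),
    Real.one_le_exp (mul_nonneg hHd (inv_nonneg.mpr (sub_nonneg.mpr hρ1.le))),
    fun l a ha b hb => (key l a ha b hb).trans ?_⟩
  have hPb := cocycle_pos h hud hP0 hP l hb
  gcongr
  rw [← tsum_geometric_of_lt_one hρ0 hρ1]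
  exact (summable_geometric_of_lt_one hρ0 hρ1).sum_le_tsum _ fun _ _ => pow_nonneg hρ0 _

lemma IFSHyp.fxw_pos (h : IFSHyp f g α d) (l : List ι) {a : ℝ × ℝ} (ha : a ∈ unitSq) :
    0 < fxw f g l a :=
  cocycle_pos h (u := fun i a => deriv (f i) a.1) (fun i _ ha => h.le_deriv_f i ha) fxw_nil
    (fxw_cons h.diff_f h.diff_g) l ha

lemma IFSHyp.gyw_pos (h : IFSHyp f g α d) (l : List ι) {a : ℝ × ℝ} (ha : a ∈ unitSq) :
    0 < gyw f g l a :=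
  cocycle_pos h (u := fun i a => fderiv ℝ (g i) a (0, 1)) (fun i _ ha => h.le_fderiv_g i ha)
    gyw_nil (gyw_cons h.diff_f h.diff_g) l ha

lemma IFSHyp.exists_fxw_distortion (h : IFSHyp f g α d) :
    ∃ C, 1 ≤ C ∧ ∀ l, ∀ a ∈ unitSq, ∀ b ∈ unitSq, fxw f g l a ≤ C * fxw f g l b := by
  obtain ⟨H, hH0, hH⟩ := h.exists_holder_deriv_f
  exact h.exists_cocycle_distortion (u := fun i a => deriv (f i) a.1)
    (fun i _ ha => h.le_deriv_f i ha) hH0 hH fxw_nil (fxw_cons h.diff_f h.diff_g)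

lemma IFSHyp.exists_gyw_distortion (h : IFSHyp f g α d) :
    ∃ C, 1 ≤ C ∧ ∀ l, ∀ a ∈ unitSq, ∀ b ∈ unitSq, gyw f g l a ≤ C * gyw f g l b := by
  obtain ⟨H, hH0, hH⟩ := h.exists_holder_fderiv_g
  exact h.exists_cocycle_distortion (u := fun i a => fderiv ℝ (g i) a (0, 1))
    (fun i _ ha => h.le_fderiv_g i ha) hH0
    (fun i a ha b hb => (abs_apply_zero_one_le (fderiv ℝ (g i) a - fderiv ℝ (g i) b)).trans
      (hH i a ha b hb)) gyw_nil (gyw_cons h.diff_f h.diff_g)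

lemma IFSHyp.gyw_le_fxw (h : IFSHyp f g α d) (l : List ι) {a : ℝ × ℝ} (ha : a ∈ unitSq) :
    gyw f g l a ≤ fxw f g l a := by
  obtain ⟨η, -, hη1, hη⟩ := h.exists_domination_ratio
  induction l with
  | nil => rw [fxw_nil, gyw_nil]
  | cons i l ih =>
    have hS := h.mapsTo_Sword l ha
    have hf := h.d_pos.le.trans (h.le_deriv_f i hS)
    rw [fxw_cons h.diff_f h.diff_g, gyw_cons h.diff_f h.diff_g]
    exact mul_le_mul ((hη i _ hS).trans (mul_le_of_le_one_left hf hη1.le)) ih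
      (h.gyw_pos l ha).le hf

/-- Domination makes the off-diagonal Jacobian entry at most a constant times `f_{𝔦,x}`. -/
lemma IFSHyp.exists_abs_gxw_le (h : IFSHyp f g α d) :
    ∃ K, 0 ≤ K ∧ ∀ l, ∀ a ∈ unitSq, |gxw f g l a| ≤ K * fxw f g l a := by
  obtain ⟨η, hη0, hη1, hη⟩ := h.exists_domination_ratio
  obtain ⟨G, hG0, hG⟩ := h.exists_norm_fderiv_g_le
  have hη' : 0 < 1 - η := sub_pos.mpr hη1
  have hd := h.d_pos
  have hK : 0 ≤ G / d / (1 - η) := by positivity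
  refine ⟨G / d / (1 - η), hK, fun l a ha => ?_⟩
  induction l with
  | nil => simpa [fxw_nil, gxw_nil] using hK
  | cons i l ih =>
    set K := G / d / (1 - η) with hKdef
    have hKeq : K * d = G + η * K * d := by
      rw [hKdef]
      field_simp
      ring
    have hS := h.mapsTo_Sword l ha
    have hx := h.fxw_pos l ha
    have hfd := h.le_deriv_f i hS
    have hgy := hd.le.trans (h.le_fderiv_g i hS)
    rw [fxw_cons h.diff_f h.diff_g, gxw_cons h.diff_f h.diff_g]
    set p := Sword f g l a
    calc _ ≤ |fderiv ℝ (g i) p (1, 0)| * fxw f g l a +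
          fderiv ℝ (g i) p (0, 1) * |gxw f g l a| := by
          refine (abs_add_le _ _).trans_eq ?_
          rw [abs_mul, abs_mul, abs_of_pos hx, abs_of_nonneg hgy]
      _ ≤ G * fxw f g l a + η * deriv (f i) p.1 * (K * fxw f g l a) := by
          gcongr
          · exact (abs_apply_one_zero_le _).trans (hG i _ hS)
          · exact hgy.trans (hη i _ hS)
          · exact hη i _ hS
      _ = (G + η * K * deriv (f i) p.1) * fxw f g l a := by ring
      _ ≤ K * deriv (f i) p.1 * fxw f g l a := by
          gcongr
          have : 0 ≤ K * (1 - η) * (deriv (f i) p.1 - d) :=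
            mul_nonneg (mul_nonneg hK hη'.le) (sub_nonneg.mpr hfd)
          linarith
      _ = _ := by ring

end Distortion

theorem singular_values_bounded_distortion {ι : Type*} [Fintype ι]
    (f : ι → ℝ → ℝ) (g : ι → ℝ × ℝ → ℝ) (α d : ℝ) (h : IFSHyp f g α d) :
    ∃ C : ℝ, 1 ≤ C ∧ ∀ l : List ι, l ≠ [] → ∀ a ∈ unitSq, ∀ b ∈ unitSq,
      (C⁻¹ * alphaOne f g l b ≤ alphaOne f g l a ∧ alphaOne f g l a ≤ C * alphaOne f g l b) ∧
      (C⁻¹ * alphaTwo f g l b ≤ alphaTwo f g l a ∧ alphaTwo f g l a ≤ C * alphaTwo f g l b) := by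
  obtain ⟨C₁, hC₁, h₁⟩ := h.exists_fxw_distortion
  obtain ⟨C₂, hC₂, h₂⟩ := h.exists_gyw_distortion
  obtain ⟨K, hK, hgx⟩ := h.exists_abs_gxw_le
  have hone : ∀ l, ∀ a ∈ unitSq,
      alphaOne f g l a ∈ Set.Icc (fxw f g l a / 2) ((2 + K) * fxw f g l a) := fun l a ha =>
    sv1_mem_Icc (h.fxw_pos l ha) (h.gyw_pos l ha).le (h.gyw_le_fxw l ha) hK (hgx l a ha)
  have htwo : ∀ l, ∀ a ∈ unitSq, gyw f g l a ≤ (2 + K) * alphaTwo f g l a ∧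
      alphaTwo f g l a ≤ 2 * gyw f g l a := by
    intro l a ha
    have hx := h.fxw_pos l ha
    have hprod : alphaOne f g l a * alphaTwo f g l a = fxw f g l a * gyw f g l a :=
      sv1_mul_sv2 hx.le (h.gyw_pos l ha).le
    have h0 : 0 ≤ alphaTwo f g l a := Real.sqrt_nonneg _
    obtain ⟨hl, hu⟩ := hone l a ha
    have := mul_le_mul_of_nonneg_right hl h0
    have := mul_le_mul_of_nonneg_right hu h0
    exact ⟨le_of_mul_le_mul_left (by linarith) hx, le_of_mul_le_mul_left (by linarith) hx⟩
  have hC : 1 ≤ 2 * (2 + K) * C₁ * C₂ := by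
    have : 1 ≤ C₁ * C₂ := one_le_mul_of_one_le_of_one_le hC₁ hC₂
    nlinarith
  have hM : ∀ l, ∀ a ∈ unitSq, ∀ b ∈ unitSq,
      alphaOne f g l a ≤ 2 * (2 + K) * C₁ * C₂ * alphaOne f g l b ∧
      alphaTwo f g l a ≤ 2 * (2 + K) * C₁ * C₂ * alphaTwo f g l b := by
    intro l a ha b hb
    have h0 : 0 ≤ alphaOne f g l b := Real.sqrt_nonneg _
    have h0' : 0 ≤ alphaTwo f g l b := Real.sqrt_nonneg _
    constructor
    · calc alphaOne f g l a ≤ (2 + K) * fxw f g l a := (hone l a ha).2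
        _ ≤ (2 + K) * (C₁ * (2 * alphaOne f g l b)) := by
          gcongr
          refine (h₁ l a ha b hb).trans ?_
          gcongr
          linarith [(hone l b hb).1]
        _ = 2 * (2 + K) * C₁ * alphaOne f g l b * 1 := by ring
        _ ≤ 2 * (2 + K) * C₁ * alphaOne f g l b * C₂ := by gcongr
        _ = _ := by ring
    · calc alphaTwo f g l a ≤ 2 * gyw f g l a := (htwo l a ha).2
        _ ≤ 2 * (C₂ * ((2 + K) * alphaTwo f g l b)) := by
          gcongr
          refine (h₂ l a ha b hb).trans ?_
          gcongr
          exact (htwo l b hb).1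
        _ = 2 * (2 + K) * C₂ * alphaTwo f g l b * 1 := by ring
        _ ≤ 2 * (2 + K) * C₂ * alphaTwo f g l b * C₁ := by gcongr
        _ = _ := by ring
  have hCpos : 0 < 2 * (2 + K) * C₁ * C₂ := one_pos.trans_le hC
  refine ⟨_, hC, fun l _ a ha b hb => ?_⟩
  obtain ⟨h1, h2⟩ := hM l a ha b hb
  obtain ⟨h3, h4⟩ := hM l b hb a ha
  exact ⟨⟨(inv_mul_le_iff₀ hCpos).mpr h3, h1⟩, (inv_mul_le_iff₀ hCpos).mpr h4, h2⟩

end
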